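/- arXiv:2504.01098 — 6 statements merged into one kernel-verified Lean document; each statement's English description precedes it below -/
import Mathlib

section
/- The bilinear form 𝔞 is coercive with constant min{η, κ}: for all v ∈ H × H one has 𝔞(v, v) ≥ min{η, κ}·‖v‖², where ‖(y,z)‖ = (‖y‖² + ‖z‖²)^{1/2}. -/
open scoped InnerProductSpace

/-- Coercivity of the bilinear form `𝔞((y,z),(p,q)) = ⟨ηy+z, p⟩ − ⟨y−κz, q⟩`
with constant `min {η, κ}`, where the norm on `H × H` satisfies `‖(y,z)‖² = ‖y‖² + ‖z‖²`. -/
theorem bilinear_form_a_coercive {H : Type*} [NormedAddCommGroup H]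
    [InnerProductSpace ℝ H] (η κ : ℝ) (hη : 0 < η) (hκ : 0 < κ)
    (y z : H) :
    min η κ * (‖y‖ ^ 2 + ‖z‖ ^ 2) ≤ ⟪η • y + z, y⟫_ℝ - ⟪y - κ • z, z⟫_ℝ := by
  have h : ⟪η • y + z, y⟫_ℝ - ⟪y - κ • z, z⟫_ℝ = η * ‖y‖ ^ 2 + κ * ‖z‖ ^ 2 := by
    rw [inner_add_left, inner_sub_left, real_inner_smul_left, real_inner_smul_left,
      real_inner_self_eq_norm_sq, real_inner_self_eq_norm_sq, real_inner_comm]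
    ring
  rw [h, mul_add]
  gcongr
  · exact min_le_left η κ
  · exact min_le_right η κ
end

section
/- Only finitely many eigenvalues lie to the right of −ω: if (λⱼ)ⱼ∈ℕ is a sequence of real numbers with λⱼ > 0 for all j and λⱼ → +∞, and 0 < ω < κ + 1/η, then the set of indices j for which some complex root μ of μ² + (κ+ηλⱼ)μ + λⱼ(1+ηκ) = 0 satisfies Re μ ≥ −ω is finite. -/
/-- A complex root of a real monic quadratic whose translate by `-ω` has positive coefficients
has real part less than `-ω`. -/
theorem re_lt_neg_of_quadratic_eq_zero {b c ω : ℝ} (hb : 2 * ω < b)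
    (hc : 0 < ω ^ 2 - b * ω + c) {μ : ℂ} (hμ : μ ^ 2 + (b : ℂ) * μ + (c : ℂ) = 0) :
    μ.re < -ω := by
  by_contra! h
  have hre := congrArg Complex.re hμ
  have him := congrArg Complex.im hμ
  simp [pow_two] at hre him
  have hy : μ.im * (2 * μ.re + b) = 0 := by linarith
  have hy0 : μ.im = 0 := (mul_eq_zero.mp hy).resolve_right (by linarith)
  rw [hy0] at hre
  nlinarith [mul_nonneg (by linarith : 0 ≤ μ.re + ω) (by linarith : 0 ≤ b - 2 * ω),
    sq_nonneg (μ.re + ω)]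

/-- Only finitely many eigenvalues lie to the right of `−ω`: if `(λⱼ)` is a sequence of
positive reals tending to `+∞` and `0 < ω < κ + 1/η`, then the set of indices `j` for which
some complex root `μ` of `μ² + (κ+ηλⱼ)μ + λⱼ(1+ηκ) = 0` satisfies `Re μ ≥ −ω` is finite. -/
theorem finitely_many_eigenvalues_right_of_omega (η κ ω : ℝ) (hη : 0 < η) (hκ : 0 < κ)
    (hω : 0 < ω) (hω' : ω < κ + 1 / η) (lam : ℕ → ℝ) (hpos : ∀ j, 0 < lam j)
    (htop : Filter.Tendsto lam Filter.atTop Filter.atTop) :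
    {j : ℕ | ∃ μ : ℂ,
        μ ^ 2 + ((κ : ℂ) + η * lam j) * μ + ((lam j : ℝ) : ℂ) * (1 + (η : ℂ) * κ) = 0 ∧
        -ω ≤ μ.re}.Finite := by
  have hd : 0 < 1 + η * κ - η * ω := by
    have h := mul_lt_mul_of_pos_left hω' hη
    rw [mul_add, mul_one_div_cancel hη.ne'] at h
    linarith
  have hfin : {j : ℕ | ¬(2 * ω / η < lam j ∧ κ * ω / (1 + η * κ - η * ω) < lam j)}.Finite := by
    have hev := (htop.eventually_gt_atTop (2 * ω / η)).and
      (htop.eventually_gt_atTop (κ * ω / (1 + η * κ - η * ω)))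
    rw [← Nat.cofinite_eq_atTop] at hev
    exact Filter.eventually_cofinite.mp hev
  refine hfin.subset ?_
  rintro j ⟨μ, hμ, hre⟩ ⟨h₁, h₂⟩
  rw [div_lt_iff₀ hη] at h₁
  rw [div_lt_iff₀ hd] at h₂
  refine hre.not_gt (re_lt_neg_of_quadratic_eq_zero (b := κ + η * lam j)
    (c := lam j * (1 + η * κ)) (by linarith) (by nlinarith [sq_nonneg ω]) ?_)
  push_cast
  exact hμ
end

section
/- Eigenvalue correspondence between A and L: for every μ ∈ ℂ with η(μ+κ) + 1 ≠ 0, μ is an eigenvalue of A if and only if μ(μ+κ)/(η(μ+κ)+1) is an eigenvalue of L. -/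
/-- Eigenvalue correspondence between `A(y,z) = (L(ηy+z), y−κz)` and `L`: for every `μ ∈ ℂ`
with `η(μ+κ)+1 ≠ 0`, `μ` is an eigenvalue of `A` if and only if `μ(μ+κ)/(η(μ+κ)+1)` is an
eigenvalue of `L`. -/
theorem eigenvalue_A_iff_eigenvalue_L {V : Type*} [AddCommGroup V] [Module ℂ V]
    (η κ : ℝ) (hη : 0 < η) (hκ : 0 < κ) (L : V →ₗ[ℂ] V) (μ : ℂ)
    (hden : (η : ℂ) * (μ + κ) + 1 ≠ 0) :
    (∃ v : V × V, v ≠ 0 ∧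
        (L ((η : ℂ) • v.1 + v.2), v.1 - (κ : ℂ) • v.2) = μ • v) ↔
      (∃ φ : V, φ ≠ 0 ∧ L φ = (μ * (μ + κ) / ((η : ℂ) * (μ + κ) + 1)) • φ) := by
  have key : ∀ z : V, L ((η : ℂ) • ((μ + κ) • z) + z) = μ • ((μ + κ) • z) ↔
      L z = (μ * (μ + κ) / ((η : ℂ) * (μ + κ) + 1)) • z := by
    intro z
    have hz : (η : ℂ) • ((μ + κ) • z) + z = ((η : ℂ) * (μ + κ) + 1) • z := by module
    rw [hz, map_smul, div_eq_inv_mul, mul_smul, eq_inv_smul_iff₀ hden, mul_smul]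
  constructor
  · rintro ⟨⟨y, z⟩, hv, h⟩
    obtain ⟨h₁, h₂⟩ := Prod.ext_iff.mp h
    simp only [Prod.smul_fst, Prod.smul_snd] at h₁ h₂
    have hy : y = (μ + κ) • z := by
      rw [add_smul]
      exact sub_eq_iff_eq_add.mp h₂
    subst hy
    refine ⟨z, ?_, (key z).mp h₁⟩
    rintro rfl
    simp at hv
  · rintro ⟨z, hz, h⟩
    refine ⟨((μ + κ) • z, z), fun h₀ => hz (congrArg Prod.snd h₀), ?_⟩
    refine Prod.ext ((key z).mpr h) ?_
    simp only [Prod.smul_snd]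
    module
end

section
/- The accumulation point is never an eigenvalue: for every linear map L : V → V, the number μ₀ = −(κ + 1/η) is not an eigenvalue of A, i.e. A(y, z) = μ₀·(y, z) implies (y, z) = (0, 0). -/
/-- The accumulation point `μ₀ = −(κ + 1/η)` is never an eigenvalue of
`A(y,z) = (L(ηy+z), y−κz)`: `A(y,z) = μ₀·(y,z)` implies `(y,z) = (0,0)`. -/
theorem accumulation_point_not_eigenvalue {V : Type*} [AddCommGroup V] [Module ℂ V]
    (η κ : ℝ) (hη : 0 < η) (hκ : 0 < κ) (L : V →ₗ[ℂ] V) (y z : V)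
    (heig : (L ((η : ℂ) • y + z), y - (κ : ℂ) • z) =
      ((-(κ + 1 / η) : ℝ) : ℂ) • ((y, z) : V × V)) :
    ((y, z) : V × V) = 0 := by
  have hη0 : (η : ℂ) ≠ 0 := by exact_mod_cast hη.ne'
  have hμ : ((-(κ + 1 / η) : ℝ) : ℂ) ≠ 0 := by
    have : 0 < κ + 1 / η := by positivity
    exact_mod_cast (neg_neg_of_pos this).ne
  rw [Prod.smul_mk, Prod.mk.injEq] at heig
  obtain ⟨h₁, h₂⟩ := heig
  have hz : (η : ℂ) • y + z = 0 := by
    have hy : y = (-(η : ℂ)⁻¹) • z := by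
      rw [sub_eq_iff_eq_add.mp h₂, ← add_smul]
      congr 1
      push_cast
      ring
    rw [hy, smul_smul, mul_neg, mul_inv_cancel₀ hη0, neg_one_smul, neg_add_cancel]
  rw [hz, map_zero] at h₁
  have hy : y = 0 := (smul_eq_zero.mp h₁.symm).resolve_left hμ
  rw [hy, smul_zero, zero_add] at hz
  rw [hy, hz, Prod.mk_zero_zero]
end

section
/- Explicit eigenvectors of A: if φ ∈ V is nonzero with L φ = −λ·φ for some real λ > 0, and μ ∈ ℂ satisfies μ² + (κ+ηλ)μ + λ(1+ηκ) = 0, then the vector ((μ+κ)·φ, φ) is nonzero and satisfies A((μ+κ)·φ, φ) = μ·((μ+κ)·φ, φ); in particular μ is an eigenvalue of A. -/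
/-- Explicit eigenvectors of `A(y,z) = (L(ηy+z), y−κz)`: if `φ ≠ 0` satisfies `Lφ = −λ·φ`
for some real `λ > 0` and `μ ∈ ℂ` satisfies `μ² + (κ+ηλ)μ + λ(1+ηκ) = 0`, then the vector
`((μ+κ)·φ, φ)` is nonzero and satisfies `A((μ+κ)·φ, φ) = μ·((μ+κ)·φ, φ)`;
in particular `μ` is an eigenvalue of `A`. -/
theorem explicit_eigenvector_of_A {V : Type*} [AddCommGroup V] [Module ℂ V]
    (η κ lam : ℝ) (hη : 0 < η) (hκ : 0 < κ) (hlam : 0 < lam) (L : V →ₗ[ℂ] V)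
    (φ : V) (hφ : φ ≠ 0) (hLφ : L φ = (-(lam : ℂ)) • φ) (μ : ℂ)
    (hroot : μ ^ 2 + ((κ : ℂ) + η * lam) * μ + (lam : ℂ) * (1 + (η : ℂ) * κ) = 0) :
    (((μ + κ) • φ, φ) : V × V) ≠ 0 ∧
      (L ((η : ℂ) • ((μ + κ) • φ) + φ), (μ + κ) • φ - (κ : ℂ) • φ) =
        μ • ((((μ + κ) • φ, φ)) : V × V) := by
  refine ⟨fun h => hφ (congrArg Prod.snd h), Prod.ext ?_ ?_⟩
  · simp only [map_add, map_smul, hLφ, Prod.smul_fst, smul_smul, ← add_smul]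
    congr 1
    linear_combination -hroot
  · simp only [Prod.smul_snd, ← sub_smul, add_sub_cancel_right]
end

section
/- Characterization of eigenvectors of the adjoint-form operator: let A'(p, q) = (L(ηp − q), −p − κq) on V × V, and let μ ∈ ℂ satisfy η(μ+κ) + 1 ≠ 0. Then (p, q) ∈ V × V is nonzero with A'(p, q) = μ·(p, q) if and only if q ≠ 0, p = −(μ+κ)·q, and L q = [μ(μ+κ)/(η(μ+κ)+1)]·q. -/
/-- Characterization of eigenvectors of the adjoint-form operator
`A'(p,q) = (L(ηp−q), −p−κq)`: for `μ ∈ ℂ` with `η(μ+κ)+1 ≠ 0`, a pair `(p,q)` is nonzero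
with `A'(p,q) = μ·(p,q)` if and only if `q ≠ 0`, `p = −(μ+κ)·q` and
`L q = [μ(μ+κ)/(η(μ+κ)+1)]·q`. -/
theorem adjoint_eigenvector_characterization {V : Type*} [AddCommGroup V] [Module ℂ V]
    (η κ : ℝ) (hη : 0 < η) (hκ : 0 < κ) (L : V →ₗ[ℂ] V) (μ : ℂ)
    (hden : (η : ℂ) * (μ + κ) + 1 ≠ 0) (p q : V) :
    (((p, q) : V × V) ≠ 0 ∧
        (L ((η : ℂ) • p - q), -p - (κ : ℂ) • q) = μ • ((p, q) : V × V)) ↔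
      (q ≠ 0 ∧ p = (-(μ + κ)) • q ∧
        L q = (μ * (μ + κ) / ((η : ℂ) * (μ + κ) + 1)) • q) := by
  have snd_iff : -p - (κ : ℂ) • q = μ • q ↔ p = (-(μ + κ)) • q := by
    constructor <;> intro h
    · calc p = -(-p - (κ : ℂ) • q) - (κ : ℂ) • q := by abel
        _ = (-(μ + κ)) • q := by rw [h]; module
    · rw [h]; module
  have fst_iff (hp : p = (-(μ + κ)) • q) : L ((η : ℂ) • p - q) = μ • p ↔
      L q = (μ * (μ + κ) / ((η : ℂ) * (μ + κ) + 1)) • q := by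
    have harg : (η : ℂ) • p - q = -(((η : ℂ) * (μ + κ) + 1) • q) := by rw [hp]; module
    have hrhs : μ • p = -((μ * (μ + κ)) • q) := by rw [hp]; module
    rw [harg, hrhs, map_neg, map_smul, neg_inj, div_eq_inv_mul, mul_smul (_)⁻¹,
      eq_inv_smul_iff₀ hden]
  have ne_iff (hp : p = (-(μ + κ)) • q) : ((p, q) : V × V) ≠ 0 ↔ q ≠ 0 := by
    refine not_congr ⟨fun h => congrArg Prod.snd h, fun h => ?_⟩
    simp [hp, h]
  rw [Prod.smul_mk, Prod.mk.injEq, snd_iff]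
  constructor
  · rintro ⟨hne, hfst, hp⟩
    exact ⟨(ne_iff hp).1 hne, hp, (fst_iff hp).1 hfst⟩
  · rintro ⟨hq, hp, hL⟩
    exact ⟨(ne_iff hp).2 hq, (fst_iff hp).2 hL, hp⟩
end
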